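/- For any rank sequence r for n, the dimension of the variety Comp(n,r) equals Σ_{i∈Z/lZ} (r_{i-1}+r_i)(n_i − r_{i-1}). -/

import Mathlib

/-!  Circular complexes framework: `K` algebraically closed, char 0;
`n : ZMod l → ℕ` a tuple of positive integers. -/

open MvPolynomial in
/-- The Zariski topology on the affine space `ι → K`: the topology generated by the
basic open sets `{x | p(x) ≠ 0}` for polynomials `p`. -/
def zariskiTopology (ι K : Type) [CommSemiring K] : TopologicalSpace (ι → K) :=
  .generateFrom { U | ∃ p : MvPolynomial ι K, U = { x | eval x p ≠ 0 } }

/-- The ambient affine space `∏_{i ∈ ℤ/lℤ} Mat_{n_{i+1} × n_i}(K)` in which the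
variety of circular complexes lives. -/
abbrev CompSpace (K : Type) [Field K] {l : ℕ} (n : ZMod l → ℕ) : Type :=
  ∀ i : ZMod l, Matrix (Fin (n (i + 1))) (Fin (n i)) K

/-- Coordinates on `CompSpace K n`. -/
def compCoord {K : Type} [Field K] {l : ℕ} (n : ZMod l → ℕ) :
    CompSpace K n → ((Σ i : ZMod l, Fin (n (i + 1)) × Fin (n i)) → K) :=
  fun A q => A q.1 q.2.1 q.2.2

/-- The Zariski topology on `CompSpace K n`, induced from the Zariski topology on
coordinates. -/
def compTopology (K : Type) [Field K] {l : ℕ} (n : ZMod l → ℕ) :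
    TopologicalSpace (CompSpace K n) :=
  (zariskiTopology _ K).induced (compCoord n)

/-- `Comp(𝐧)`, the variety of circular complexes: tuples `(A_i)` with
`A_{i+1} A_i = 0` for all `i ∈ ℤ/lℤ`. -/
def Comp (K : Type) [Field K] {l : ℕ} (n : ZMod l → ℕ) : Set (CompSpace K n) :=
  { A | ∀ i : ZMod l, A (i + 1) * A i = 0 }

/-- `Comp(𝐧,𝐫)`: circular complexes with `rank A_i ≤ r_i` for all `i`. -/
def CompR (K : Type) [Field K] {l : ℕ} (n r : ZMod l → ℕ) : Set (CompSpace K n) :=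
  { A ∈ Comp K n | ∀ i, (A i).rank ≤ r i }

/-- `Comp⁰(𝐧,𝐫)`: circular complexes with `rank A_i = r_i` for all `i`. -/
def Comp0 (K : Type) [Field K] {l : ℕ} (n r : ZMod l → ℕ) : Set (CompSpace K n) :=
  { A ∈ Comp K n | ∀ i, (A i).rank = r i }

/-- `r` is a rank sequence for `n`: it is realized by some circular complex. -/
def IsRankSeq (K : Type) [Field K] {l : ℕ} (n r : ZMod l → ℕ) : Prop :=
  ∃ A ∈ Comp K n, ∀ i, (A i).rank = r i

section ZariskiTopology

open MvPolynomial TopologicalSpace Topology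

attribute [local instance] zariskiTopology

variable {ι τ K : Type} [Field K]

theorem zariski_isTopologicalBasis :
    IsTopologicalBasis {U : Set (ι → K) | ∃ p : MvPolynomial ι K, U = {x | eval x p ≠ 0}} where
  exists_subset_inter := by
    rintro _ ⟨p, rfl⟩ _ ⟨q, rfl⟩ x ⟨hp, hq⟩
    refine ⟨_, ⟨p * q, rfl⟩, by simpa using ⟨hp, hq⟩, fun y hy => ?_⟩
    simpa using hy
  sUnion_eq := Set.eq_univ_of_forall fun x => ⟨_, ⟨1, rfl⟩, by simp⟩
  eq_generateFrom := rfl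

theorem zariski_isOpen_ne (p : MvPolynomial ι K) : IsOpen {x : ι → K | eval x p ≠ 0} :=
  zariski_isTopologicalBasis.isOpen ⟨p, rfl⟩

theorem zariski_isClosed_eq (p : MvPolynomial ι K) : IsClosed {x : ι → K | eval x p = 0} :=
  ⟨by simpa only [Set.compl_ofPred] using zariski_isOpen_ne p⟩

/-- The polynomial map `Kᵗ → Kⁱ` with coordinate polynomials `F`. -/
noncomputable def polyMap (F : ι → MvPolynomial τ K) (x : τ → K) : ι → K := fun i => eval x (F i)

theorem eval_polyMap (F : ι → MvPolynomial τ K) (x : τ → K) (p : MvPolynomial ι K) :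
    eval (polyMap F x) p = eval x (aeval F p) := by
  induction p using MvPolynomial.induction_on with
  | C a => simp
  | add p q hp hq => simp [hp, hq]
  | mul_X p i hp => simp [hp, polyMap]

theorem continuous_polyMap (F : ι → MvPolynomial τ K) : Continuous (polyMap F) := by
  refine continuous_generateFrom_iff.2 ?_
  rintro _ ⟨p, rfl⟩
  simpa only [Set.preimage_ofPred_eq, eval_polyMap] using zariski_isOpen_ne (aeval F p)

theorem isIrreducible_univ_zariski [Infinite K] : IsIrreducible (Set.univ : Set (τ → K)) := by
  refine ⟨⟨0, trivial⟩, ?_⟩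
  rintro U V hU hV ⟨x, -, hx⟩ ⟨y, -, hy⟩
  obtain ⟨_, ⟨p, rfl⟩, hxp, hp⟩ := zariski_isTopologicalBasis.exists_subset_of_mem_open hx hU
  obtain ⟨_, ⟨q, rfl⟩, hyq, hq⟩ := zariski_isTopologicalBasis.exists_subset_of_mem_open hy hV
  have hpq : p * q ≠ 0 := by
    refine mul_ne_zero ?_ ?_ <;> rintro rfl
    · simp at hxp
    · simp at hyq
  obtain ⟨z, hz⟩ : ∃ z, eval z (p * q) ≠ 0 := by
    by_contra! h
    exact hpq (MvPolynomial.funext fun z => by simpa using h z)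
  rw [map_mul] at hz
  exact ⟨z, trivial, hp (left_ne_zero_of_mul hz), hq (right_ne_zero_of_mul hz)⟩

/-- The ideal of polynomials vanishing on an irreducible subset is prime. -/
theorem isPrime_vanishingIdeal {Z : Set (ι → K)} (hZ : IsIrreducible Z) :
    (vanishingIdeal K Z).IsPrime := by
  refine ⟨fun h => ?_, fun {p q} hpq => ?_⟩
  · obtain ⟨x, hx⟩ := hZ.nonempty
    have : (1 : MvPolynomial ι K) ∈ vanishingIdeal K Z := h ▸ Submodule.mem_top
    simpa using mem_vanishingIdeal_iff.1 this x hx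
  · have hsub : Z ⊆ {x | eval x p = 0} ∪ {x | eval x q = 0} := fun x hx => by
      simpa [aeval_eq_eval] using mem_vanishingIdeal_iff.1 hpq x hx
    refine (isPreirreducible_iff_isClosed_union_isClosed.1 hZ.isPreirreducible _ _
      (zariski_isClosed_eq p) (zariski_isClosed_eq q) hsub).imp ?_ ?_ <;>
    · intro h
      exact mem_vanishingIdeal_iff.2 fun x hx => by simpa [aeval_eq_eval] using h hx

theorem vanishingIdeal_lt_of_lt {S : Set (ι → K)} {Y Z : IrreducibleCloseds S} (h : Y < Z) :
    vanishingIdeal K (Subtype.val '' (Z : Set S)) <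
      vanishingIdeal K (Subtype.val '' (Y : Set S)) := by
  have hYZ : (Y : Set S) ⊂ Z := h
  obtain ⟨hle, x, hxZ, hxY⟩ := Set.ssubset_iff_exists.1 hYZ
  refine lt_of_le_not_ge (vanishingIdeal_anti_mono (Set.image_mono hle)) fun hge => ?_
  obtain ⟨U, hU, hUY⟩ := isOpen_induced_iff.1 Y.isClosed.isOpen_compl
  have hxU : (x : ι → K) ∈ U := by
    change x ∈ Subtype.val ⁻¹' U
    rw [hUY]
    exact hxY
  obtain ⟨_, ⟨p, rfl⟩, hxp, hp⟩ := zariski_isTopologicalBasis.exists_subset_of_mem_open hxU hU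
  have hpY : p ∈ vanishingIdeal K (Subtype.val '' (Y : Set S)) := by
    rw [mem_vanishingIdeal_iff]
    rintro _ ⟨y, hy, rfl⟩
    by_contra hne
    have : y ∈ Subtype.val ⁻¹' U := hp (by simpa [aeval_eq_eval] using hne)
    rw [hUY] at this
    exact this hy
  exact hxp (by simpa [aeval_eq_eval] using
    mem_vanishingIdeal_iff.1 (hge hpY) x ⟨x, hxZ, rfl⟩)

theorem ringKrullDim_le_of_injective_mvPolynomial [Fintype τ] {A : Type} [CommRing A]
    [Algebra K A] [Algebra.FiniteType K A] (φ : A →ₐ[K] MvPolynomial τ K)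
    (hφ : Function.Injective φ) : ringKrullDim A ≤ Fintype.card τ := by
  have : Nontrivial A := φ.toRingHom.domain_nontrivial
  obtain ⟨s, g, hg, hfin⟩ := exists_finite_inj_algHom_of_fg K A
  have hintegral : g.toRingHom.IsIntegral := hfin.to_isIntegral
  algebraize [g.toRingHom]
  have hdim : ringKrullDim A ≤ ringKrullDim (MvPolynomial (Fin s) K) := by
    refine Order.krullDim_le_of_strictMono (PrimeSpectrum.comap g.toRingHom) fun P Q hPQ => ?_
    exact Ideal.IsIntegral.comap_lt_comap hPQ
  have hs : s ≤ Fintype.card τ := by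
    have hind : AlgebraicIndependent K fun i => φ (g (X i)) := by
      rw [algebraicIndependent_iff_injective_aeval]
      convert! hφ.comp hg using 1
      have : aeval (fun i => φ (g (X i))) = φ.comp g := by ext; simp
      rw [this]; rfl
    have := hind.cardinalMk_le_trdeg
    rw [MvPolynomial.trdeg_of_isDomain] at this
    simpa using this
  refine hdim.trans ?_
  rw [MvPolynomial.ringKrullDim_of_isNoetherianRing, ringKrullDim_eq_zero_of_field]
  simpa using hs

theorem krullDim_zeroLocus_ker_aeval_le [Finite ι] [Fintype τ] (F : ι → MvPolynomial τ K) :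
    Order.krullDim (PrimeSpectrum.zeroLocus (R := MvPolynomial ι K)
      (RingHom.ker (aeval (R := K) F) : Ideal (MvPolynomial ι K))) ≤ Fintype.card τ := by
  rw [← ringKrullDim_quotient]
  let φ : MvPolynomial ι K →ₐ[K] MvPolynomial τ K := aeval F
  exact ringKrullDim_le_of_injective_mvPolynomial (Ideal.kerLiftAlg φ)
    (Ideal.kerLiftAlg_injective φ)

/-- A set covered by finitely many polynomial images of `Kᵗ` has dimension at most `|τ|`. -/
theorem topologicalKrullDim_le_of_subset_iUnion_range [Finite ι] [Fintype τ] {σ : Type} [Finite σ]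
    (F : σ → ι → MvPolynomial τ K) {S : Set (ι → K)} (hS : S ⊆ ⋃ s, Set.range (polyMap (F s))) :
    topologicalKrullDim S ≤ Fintype.card τ := by
  have := Fintype.ofFinite σ
  refine iSup_le fun c => ?_
  have hprime (Z : IrreducibleCloseds S) :
      (vanishingIdeal K (Subtype.val '' (Z : Set S))).IsPrime :=
    isPrime_vanishingIdeal (Z.isIrreducible.image _ continuous_subtype_val.continuousOn)
  obtain ⟨s, -, hs⟩ := (hprime c.last).inf_le'.1
    (show Finset.univ.inf (fun s => RingHom.ker (aeval (R := K) (F s))) ≤ _ from fun p hp => by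
      rw [mem_vanishingIdeal_iff]
      rintro _ ⟨x, -, rfl⟩
      obtain ⟨s, y, hy⟩ := Set.mem_iUnion.1 (hS x.2)
      have : p ∈ RingHom.ker (aeval (F s)) := Finset.inf_le
        (f := fun s => RingHom.ker (aeval (R := K) (F s))) (Finset.mem_univ s) hp
      rw [aeval_eq_eval, ← hy, eval_polyMap, (RingHom.mem_ker).1 this, map_zero])
  let d : LTSeries (PrimeSpectrum.zeroLocus (R := MvPolynomial ι K)
      (RingHom.ker (aeval (R := K) (F s)) : Ideal (MvPolynomial ι K))) :=
    LTSeries.mk c.length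
      (fun j => ⟨⟨_, hprime (c j.rev)⟩, fun p hp =>
        vanishingIdeal_anti_mono (Set.image_mono
          (show (c j.rev : Set S) ⊆ c.last from c.monotone (Fin.le_last _))) (hs hp)⟩)
      (fun i j hij => vanishingIdeal_lt_of_lt (c.strictMono (Fin.rev_lt_rev.2 hij)))
  exact (Order.LTSeries.length_le_krullDim d).trans (krullDim_zeroLocus_ker_aeval_le (F s))

/-- A polynomial map that is generically injective, with rational inverse, has image of
dimension at least `|τ|`. -/
theorem card_le_topologicalKrullDim [Infinite K] [Fintype τ] (F : ι → MvPolynomial τ K)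
    {S : Set (ι → K)} (hS : Set.range (polyMap F) ⊆ S)
    (hF : ∀ j, ∃ P Q : MvPolynomial ι K, aeval F Q ≠ 0 ∧ aeval F P = X j * aeval F Q) :
    (Fintype.card τ : WithBot ℕ∞) ≤ topologicalKrullDim S := by
  classical
  choose P Q hQ hPQ using hF
  obtain ⟨p, hp⟩ : ∃ p, eval p (∏ j, aeval F (Q j)) ≠ 0 := by
    by_contra! h
    exact Finset.prod_ne_zero_iff.2 (fun j _ => hQ j)
      (MvPolynomial.funext fun z => by simpa using h z)
  rw [map_prod, Finset.prod_ne_zero_iff] at hp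
  let e := Fintype.equivFin τ
  let T (k : ℕ) : τ → MvPolynomial τ K := fun j => if (e j : ℕ) < k then X j else C (p j)
  have hT (k : ℕ) (x : τ → K) (j : τ) : polyMap (T k) x j = if (e j : ℕ) < k then x j else p j := by
    simp only [polyMap, T]; split_ifs <;> simp
  let f (k : ℕ) (x : τ → K) : S := ⟨polyMap F (polyMap (T k) x), hS ⟨_, rfl⟩⟩
  have hf (k : ℕ) : Continuous (f k) :=
    ((continuous_polyMap F).comp (continuous_polyMap (T k))).subtype_mk _
  let Z (k : ℕ) : IrreducibleCloseds S :=
    ⟨closure (Set.range (f k)), by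
      rw [← Set.image_univ]
      exact (isIrreducible_univ_zariski.image _ (hf k).continuousOn).closure, isClosed_closure⟩
  have hZ (k : Fin (Fintype.card τ)) : Z k < Z (k + 1) := by
    let j := e.symm k
    have hj : (e j : ℕ) = k := by simp [j]
    change (closure (Set.range (f k)) : Set S) ⊂ closure (Set.range (f (k + 1)))
    refine Set.ssubset_iff_exists.2 ⟨closure_mono ?_, ?_⟩
    · rintro _ ⟨x, rfl⟩
      refine ⟨polyMap (T k) x, Subtype.ext (congrArg (polyMap F) (funext fun i => ?_))⟩
      rw [hT, hT]
      split_ifs <;> first | rfl | omega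
    · have hcl : IsClosed {x : S | eval (x : ι → K) (P j - C (p j) * Q j) = 0} :=
        (zariski_isClosed_eq _).preimage continuous_subtype_val
      have heval (x : τ → K) : eval (polyMap F x) (P j - C (p j) * Q j) =
          (x j - p j) * eval x (aeval F (Q j)) := by
        rw [eval_polyMap, map_sub, map_mul, hPQ, algHom_C]
        simp only [map_sub, map_mul, eval_X, algebraMap_eq, eval_C]
        ring
      obtain ⟨x, hx⟩ : ∃ x : K, eval (Function.update p j x)
          ((X j - C (p j)) * aeval F (Q j)) ≠ 0 := by
        have hU : IsOpen {x : Unit → K | eval (Function.update p j (x ()))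
            (aeval F (Q j)) ≠ 0} := by
          have hc := continuous_polyMap
            (fun i => if i = j then X () else C (p i) : τ → MvPolynomial Unit K)
          convert! (zariski_isOpen_ne (aeval F (Q j))).preimage hc using 1
          ext x
          have : polyMap (fun i => if i = j then X () else C (p i) : τ → MvPolynomial Unit K) x =
              Function.update p j (x ()) := by
            ext i
            by_cases h : i = j
            · subst h; simp [polyMap]
            · simp [polyMap, h]
          simp [this]
        obtain ⟨x, -, h1, h2⟩ := isIrreducible_univ_zariski.2 _ _ hU
          (zariski_isOpen_ne (X () - C (p j) : MvPolynomial Unit K))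
          ⟨fun _ => p j, trivial, by simpa using hp j (Finset.mem_univ j)⟩
          ⟨fun _ => p j + 1, trivial, by simp⟩
        exact ⟨x (), by simpa using ⟨by simpa using h2, h1⟩⟩
      refine ⟨f (k + 1) (Function.update p j x), subset_closure ⟨_, rfl⟩, fun hmem => ?_⟩
      have h0 := closure_minimal (t := {x : S | eval (x : ι → K) (P j - C (p j) * Q j) = 0})
        (by
          rintro _ ⟨y, rfl⟩
          change eval (polyMap F _) _ = 0
          rw [heval, hT, if_neg (by omega), sub_self, zero_mul]) hcl hmem
      have hup : polyMap (T (k + 1)) (Function.update p j x) = Function.update p j x := by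
        ext i
        rw [hT]
        split_ifs with h
        · rfl
        · rw [Function.update_of_ne]
          rintro rfl
          omega
      change eval (polyMap F _) _ = 0 at h0
      rw [hup, heval] at h0
      exact hx (by simpa using h0)
  let c : LTSeries (IrreducibleCloseds S) :=
    LTSeries.mk (Fintype.card τ) (fun k => Z k)
      (Fin.strictMono_iff_lt_succ.2 fun k => by simpa using hZ k)
  exact Order.LTSeries.length_le_krullDim c

end ZariskiTopology

section Charts

open Module Submodule

theorem Submodule.exists_between_finrank_eq {K V : Type*} [Field K] [AddCommGroup V] [Module K V]
    [FiniteDimensional K V] {U W : Submodule K V} (hUW : U ≤ W) {a : ℕ} (hU : finrank K U ≤ a)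
    (hW : a ≤ finrank K W) : ∃ B : Submodule K V, U ≤ B ∧ B ≤ W ∧ finrank K B = a := by
  induction a, hU using Nat.le_induction with
  | base => exact ⟨U, le_rfl, hUW, rfl⟩
  | succ a _ ih =>
    obtain ⟨B, hUB, hBW, hB⟩ := ih (by omega)
    obtain ⟨v, hvW, hvB⟩ : ∃ v ∈ W, v ∉ B := by
      by_contra! h
      have := finrank_mono (show W ≤ B from h)
      omega
    refine ⟨B ⊔ span K {v}, hUB.trans le_sup_left,
      sup_le hBW ((span_singleton_le_iff_mem _ _).2 hvW), ?_⟩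
    rw [finrank_sup_span_singleton hvB, hB]

theorem exists_equiv_sum_of_injective {a b N : ℕ} (h : a + b = N) {g : Fin a → Fin N}
    (hg : Function.Injective g) :
    ∃ e : Fin N ≃ Fin a ⊕ Fin b, ∀ t, e.symm (Sum.inl t) = g t := by
  classical
  have hcard : Fintype.card ((Set.range g)ᶜ : Set (Fin N)) = b := by
    rw [Fintype.card_compl_set, Set.card_range_of_injective hg, Fintype.card_fin, Fintype.card_fin]
    omega
  refine ⟨((Equiv.sumCongr (Equiv.ofInjective g hg) (Fintype.equivFinOfCardEq hcard).symm).trans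
    (Equiv.Set.sumCompl (Set.range g))).symm, fun t => ?_⟩
  simp

/-- After splitting the coordinates suitably, a subspace of `Kᴺ` of dimension `a` is the graph of
a linear map between coordinate subspaces. -/
theorem Submodule.exists_split_eq_graph {K : Type*} [Field K] {a b N : ℕ} (h : a + b = N)
    (B : Submodule K (Fin N → K)) (hB : finrank K B = a) :
    ∃ (e : Fin N ≃ Fin a ⊕ Fin b) (M : Matrix (Fin b) (Fin a) K),
      (∀ v ∈ B, ∀ s, v (e.symm (.inr s)) = ∑ t, M s t * v (e.symm (.inl t))) ∧
      ∀ u : Fin a → K, (fun k => Sum.elim u (M.mulVec u) (e k)) ∈ B := by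
  let φ : Fin N → Dual K B := fun j => (LinearMap.proj j).comp B.subtype
  obtain ⟨κ, c, hc, hspan, hli⟩ := exists_linearIndependent' K φ
  have : Fintype κ := Fintype.ofInjective c hc
  have hmem (j : Fin N) : φ j ∈ span K (Set.range (φ ∘ c)) :=
    hspan ▸ subset_span (Set.mem_range_self j)
  simp only [mem_span_range_iff_exists_fun] at hmem
  choose w hw using hmem
  have hwv (v : B) (j : Fin N) : (v : Fin N → K) j = ∑ k, w j k * (v : Fin N → K) (c k) := by
    have := LinearMap.congr_fun (hw j) v
    simpa [φ] using this.symm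
  let r : B →ₗ[K] (κ → K) := LinearMap.pi fun k => φ (c k)
  have hr : Function.Injective r := by
    refine (injective_iff_map_eq_zero r).2 fun v hv => Subtype.ext (funext fun j => ?_)
    rw [hwv v j]
    exact Finset.sum_eq_zero fun k _ => by
      have : (v : Fin N → K) (c k) = 0 := congrFun hv k
      rw [this, mul_zero]
  have hκ : Fintype.card κ = a := by
    refine le_antisymm ?_ ?_
    · have := hli.fintype_card_le_finrank
      rwa [Subspace.dual_finrank_eq, hB] at this
    · have := LinearMap.finrank_le_finrank_of_injective hr
      rwa [hB, finrank_fintype_fun_eq_card] at this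
  have hsurj : Function.Surjective r :=
    (LinearMap.injective_iff_surjective_of_finrank_eq_finrank
      (by rw [hB, finrank_fintype_fun_eq_card, hκ])).1 hr
  let ε := (Fintype.equivFinOfCardEq hκ).symm
  obtain ⟨e, he⟩ := exists_equiv_sum_of_injective h (hc.comp ε.injective)
  have hgraph (v : B) (s : Fin b) : (v : Fin N → K) (e.symm (.inr s)) =
      ∑ t, w (e.symm (.inr s)) (ε t) * (v : Fin N → K) (e.symm (.inl t)) := by
    simp only [he, Function.comp_apply]
    rw [hwv v, ← ε.sum_comp]
  refine ⟨e, .of fun s t => w (e.symm (.inr s)) (ε t), fun v hv => hgraph ⟨v, hv⟩, fun u => ?_⟩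
  obtain ⟨v, hv⟩ := hsurj (u ∘ ε.symm)
  have hvu (t : Fin a) : (v : Fin N → K) (e.symm (.inl t)) = u t := by
    rw [he]
    simpa [r, φ] using congrFun hv (ε t)
  convert! v.2 using 1
  funext k
  obtain ⟨k, rfl⟩ := e.symm.surjective k
  rw [Equiv.apply_symm_apply]
  cases k with
  | inl t => exact (hvu t).symm
  | inr s => simp [hgraph, hvu, Matrix.mulVec, dotProduct]

variable {l : ℕ} {n a b : ZMod l → ℕ}

/-- Index type for the matrix entries of the pairs `(M_i, Y_i)` parametrizing a chart. -/
abbrev ChartIndex (a b : ZMod l → ℕ) : Type :=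
  Σ i : ZMod l, (Fin (b i) × Fin (a i)) ⊕ (Fin (a (i + 1)) × Fin (b i))

/-- The matrix `M_i`, whose graph is the subspace between image and kernel at vertex `i`. -/
def chartGraph {R : Type} (x : ChartIndex a b → R) (i : ZMod l) :
    Matrix (Fin (b i)) (Fin (a i)) R :=
  .of fun s t => x ⟨i, .inl (s, t)⟩

/-- The matrix `Y_i` of the map induced between the quotient at `i` and the subspace at `i + 1`. -/
def chartMap {R : Type} (x : ChartIndex a b → R) (i : ZMod l) :
    Matrix (Fin (a (i + 1))) (Fin (b i)) R :=
  .of fun s t => x ⟨i, .inr (s, t)⟩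

/-- The circular complex with chart coordinates `x`, with respect to the splittings `e` of the
coordinates at each vertex. -/
def chart (e : ∀ i, Fin (n i) ≃ Fin (a i) ⊕ Fin (b i)) {R : Type} [CommRing R]
    (x : ChartIndex a b → R) (i : ZMod l) : Matrix (Fin (n (i + 1))) (Fin (n i)) R :=
  (Matrix.fromRows 1 (chartGraph x (i + 1)) * chartMap x i *
    Matrix.fromCols (-chartGraph x i) 1).submatrix (e (i + 1)) (e i)

variable (e : ∀ i, Fin (n i) ≃ Fin (a i) ⊕ Fin (b i)) {R S : Type} [CommRing R] [CommRing S]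

theorem chart_eq_fromBlocks (x : ChartIndex a b → R) (i : ZMod l) :
    chart e x i = (Matrix.fromBlocks (-(chartMap x i * chartGraph x i)) (chartMap x i)
      (-(chartGraph x (i + 1) * chartMap x i * chartGraph x i))
      (chartGraph x (i + 1) * chartMap x i)).submatrix (e (i + 1)) (e i) := by
  simp [chart, Matrix.fromRows_mul]

theorem map_chart (φ : R →+* S) (x : ChartIndex a b → R) (i : ZMod l) :
    (chart e x i).map φ = chart e (φ ∘ x) i := by
  have hG (i : ZMod l) : (chartGraph x i).map φ = chartGraph (φ ∘ x) i := rfl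
  have hY : (chartMap x i).map φ = chartMap (φ ∘ x) i := rfl
  have hneg {p q : Type} (M : Matrix p q R) : (-M).map φ = -(M.map φ) := by ext; simp
  simp only [chart_eq_fromBlocks, ← Matrix.submatrix_map, Matrix.fromBlocks_map, hneg,
    Matrix.map_mul, hG, hY]

theorem chart_inl_inr (x : ChartIndex a b → R) (i : ZMod l) (s : Fin (a (i + 1))) (t : Fin (b i)) :
    chart e x i ((e (i + 1)).symm (.inl s)) ((e i).symm (.inr t)) = chartMap x i s t := by
  simp [chart_eq_fromBlocks]

theorem chart_inr_inr (x : ChartIndex a b → R) (i : ZMod l) (s : Fin (b (i + 1))) (t : Fin (b i)) :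
    chart e x i ((e (i + 1)).symm (.inr s)) ((e i).symm (.inr t)) =
      (chartGraph x (i + 1) * chartMap x i) s t := by
  simp [chart_eq_fromBlocks]

theorem chart_mul_chart (x : ChartIndex a b → R) (i : ZMod l) :
    chart e x (i + 1) * chart e x i = 0 := by
  have : Matrix.fromCols (-chartGraph x (i + 1))
      (1 : Matrix (Fin (b (i + 1))) (Fin (b (i + 1))) R) *
      Matrix.fromRows (1 : Matrix (Fin (a (i + 1))) (Fin (a (i + 1))) R)
        (chartGraph x (i + 1)) = 0 := by
    simp [Matrix.fromCols_mul_fromRows]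
  rw [chart, chart, Matrix.submatrix_mul_equiv, Matrix.mul_assoc, ← Matrix.mul_assoc _ _
    (Matrix.fromCols (-chartGraph x i) 1), ← Matrix.mul_assoc _ _ (chartMap x i), this]
  simp

theorem rank_chart_le {K : Type} [Field K] (x : ChartIndex a b → K) (i : ZMod l) :
    (chart e x i).rank ≤ a (i + 1) := by
  rw [chart, Matrix.rank_submatrix]
  refine (Matrix.rank_mul_le_left _ _).trans ((Matrix.rank_mul_le_left _ _).trans ?_)
  simpa using Matrix.rank_le_card_width (Matrix.fromRows 1 (chartGraph x (i + 1)))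

open MvPolynomial

/-- The polynomials giving the matrix entries of `chart`. -/
noncomputable def chartPoly (K : Type) [Field K] (q : Σ i : ZMod l, Fin (n (i + 1)) × Fin (n i)) :
    MvPolynomial (ChartIndex a b) K :=
  chart e X q.1 q.2.1 q.2.2

theorem polyMap_chartPoly {K : Type} [Field K] (x : ChartIndex a b → K) :
    polyMap (chartPoly e K) x = compCoord n (chart e x) := by
  funext q
  have := congrFun (congrFun (map_chart e (eval x) X q.1) q.2.1) q.2.2
  have hx : (eval x : MvPolynomial (ChartIndex a b) K →+* K) ∘ X = x := by
    funext; simp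
  rw [hx] at this
  exact this

/-- The chart has a rational inverse. -/
theorem chartPoly_rational_inverse {K : Type} [Field K] (hab : ∀ i, a (i + 1) ≤ b i)
    (j : ChartIndex a b) : ∃ P Q : MvPolynomial (Σ i : ZMod l, Fin (n (i + 1)) × Fin (n i)) K,
      aeval (chartPoly e K) Q ≠ 0 ∧
        aeval (chartPoly e K) P = X j * aeval (chartPoly e K) Q := by
  obtain ⟨i, ⟨s, t⟩ | ⟨s, t⟩⟩ := j
  · obtain ⟨i, rfl⟩ : ∃ k, i = k + 1 := ⟨i - 1, by simp⟩
    let c : Fin (a (i + 1)) → Fin (b i) := Fin.castLE (hab i)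
    let ψ : MvPolynomial (Σ i : ZMod l, Fin (n (i + 1)) × Fin (n i)) K →ₐ[K]
      MvPolynomial (ChartIndex a b) K := aeval (chartPoly e K)
    let Y : Matrix (Fin (a (i + 1))) (Fin (a (i + 1)))
        (MvPolynomial (Σ i : ZMod l, Fin (n (i + 1)) × Fin (n i)) K) :=
      .of fun u v => X ⟨i, (e (i + 1)).symm (.inl u), (e i).symm (.inr (c v))⟩
    let M : Matrix (Fin (b (i + 1))) (Fin (a (i + 1)))
        (MvPolynomial (Σ i : ZMod l, Fin (n (i + 1)) × Fin (n i)) K) :=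
      .of fun u v => X ⟨i, (e (i + 1)).symm (.inr u), (e i).symm (.inr (c v))⟩
    let Y' : Matrix (Fin (a (i + 1))) (Fin (a (i + 1))) (MvPolynomial (ChartIndex a b) K) :=
      (chartMap X i).submatrix id c
    let G : Matrix (Fin (b (i + 1))) (Fin (a (i + 1))) (MvPolynomial (ChartIndex a b) K) :=
      chartGraph X (i + 1)
    have hY : ψ.mapMatrix Y = Y' := by
      ext1 u v
      simpa [ψ, Y, chartPoly, Y'] using chart_inl_inr e X i u (c v)
    have hM : M.map ψ = G * Y' := by
      ext1 u v
      simpa [ψ, M, chartPoly] using! chart_inr_inr e X i u (c v)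
    refine ⟨(M * Y.adjugate) s t, Y.det, ?_, ?_⟩
    · change ψ Y.det ≠ 0
      rw [AlgHom.map_det, hY]
      intro h0
      let x : ChartIndex a b → K := fun
        | ⟨k, .inl _⟩ => 0
        | ⟨k, .inr (u, v)⟩ => if (u : ℕ) = v then 1 else 0
      have h1 : (eval x).mapMatrix Y' = 1 := by
        ext u v
        simp [Y', chartMap, x, c, Matrix.one_apply, Fin.ext_iff]
      have := congrArg (eval x) h0
      rw [RingHom.map_det, h1, Matrix.det_one, map_zero] at this
      exact one_ne_zero this
    · have h1 : Y.adjugate.map ψ = Y'.adjugate := by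
        rw [← AlgHom.mapMatrix_apply, AlgHom.map_adjugate, hY]
      have h2 : (M * Y.adjugate).map ψ = Y'.det • G := by
        rw [Matrix.map_mul, hM, h1, Matrix.mul_assoc, Matrix.mul_adjugate]
        simp
      have h3 := congrFun (congrFun h2 s) t
      change ψ _ = _ at h3
      change ψ _ = _ * ψ Y.det
      rw [h3, AlgHom.map_det, hY]
      simp [G, chartGraph, mul_comm]
  · refine ⟨X ⟨i, (e (i + 1)).symm (.inl s), (e i).symm (.inr t)⟩, 1, by simp, ?_⟩
    simpa [chartPoly] using! chart_inl_inr e X i s t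

end Charts

section Covering

open Matrix Module

variable {K : Type} [Field K] {l : ℕ} {n a b : ZMod l → ℕ}

theorem chart_mem_CompR (e : ∀ i, Fin (n i) ≃ Fin (a i) ⊕ Fin (b i)) {r : ZMod l → ℕ}
    (hr : ∀ i, a (i + 1) = r i) (x : ChartIndex a b → K) : chart e x ∈ CompR K n r :=
  ⟨chart_mul_chart e x, fun i => (rank_chart_le e x i).trans (hr i).le⟩

theorem exists_intermediate_subspaces {r : ZMod l → ℕ} (har : ∀ i, a (i + 1) = r i)
    (hab : ∀ i, a i + b i = n i) (hrb : ∀ i, a (i + 1) ≤ b i) {A : CompSpace K n}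
    (hA : A ∈ CompR K n r) (i : ZMod l) :
    ∃ B : Submodule K (Fin (n i) → K), finrank K B = a i ∧ (∀ v ∈ B, A i *ᵥ v = 0) ∧
      ∀ j (h : j + 1 = i) w, (fun s => (A j *ᵥ w) (Fin.cast (by rw [h]) s)) ∈ B := by
  obtain ⟨k, rfl⟩ : ∃ k, i = k + 1 := ⟨i - 1, by simp⟩
  have hle : LinearMap.range (A k).mulVecLin ≤ LinearMap.ker (A (k + 1)).mulVecLin := by
    rintro _ ⟨w, rfl⟩
    simp [mulVec_mulVec, hA.1 k]
  have hker := (A (k + 1)).mulVecLin.finrank_range_add_finrank_ker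
  rw [finrank_fintype_fun_eq_card, Fintype.card_fin] at hker
  have hrk : finrank K (LinearMap.range (A (k + 1)).mulVecLin) ≤ r (k + 1) := hA.2 (k + 1)
  have h1 := hab (k + 1)
  have h2 := hrb (k + 1)
  have h3 := har (k + 1)
  obtain ⟨B, hB, hB', hBa⟩ := Submodule.exists_between_finrank_eq hle (a := a (k + 1))
    ((hA.2 k).trans (har k).ge) (by omega)
  refine ⟨B, hBa, fun v hv => hB' hv, fun j h w => ?_⟩
  obtain rfl : j = k := add_right_cancel h
  exact hB ⟨w, rfl⟩

/-- Every complex with ranks bounded by `r` lies in one of the charts. -/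
theorem exists_chart_eq {r : ZMod l → ℕ} (har : ∀ i, a (i + 1) = r i)
    (hab : ∀ i, a i + b i = n i) (hrb : ∀ i, a (i + 1) ≤ b i) {A : CompSpace K n}
    (hA : A ∈ CompR K n r) :
    ∃ (e : ∀ i, Fin (n i) ≃ Fin (a i) ⊕ Fin (b i)) (x : ChartIndex a b → K), chart e x = A := by
  choose B hB hker himg using exists_intermediate_subspaces har hab hrb hA
  choose e M hM hMB using fun i => (B i).exists_split_eq_graph (hab i) (hB i)
  let x : ChartIndex a b → K := fun
    | ⟨i, .inl (s, t)⟩ => M i s t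
    | ⟨i, .inr (s, t)⟩ => A i ((e (i + 1)).symm (.inl s)) ((e i).symm (.inr t))
  refine ⟨e, x, ?_⟩
  have hG (i : ZMod l) : chartGraph x i = M i := rfl
  funext i
  let D := (A i).submatrix (e (i + 1)).symm (e i).symm
  have hY : chartMap x i = D.toBlocks₁₂ := rfl
  have hrow (s : Fin (b (i + 1))) (k : Fin (n i)) : A i ((e (i + 1)).symm (.inr s)) k =
      ∑ t, M (i + 1) s t * A i ((e (i + 1)).symm (.inl t)) k := by
    have := hM (i + 1) _ (himg (i + 1) i rfl (Pi.single k 1)) s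
    simpa using this
  have hcol (p : Fin (n (i + 1))) (t : Fin (a i)) : A i p ((e i).symm (.inl t)) =
      -∑ s, A i p ((e i).symm (.inr s)) * M i s t := by
    have := congrFun (hker i _ (hMB i (Pi.single t 1))) p
    rw [mulVec, dotProduct, ← (e i).symm.sum_comp] at this
    simpa [Fintype.sum_sum_type, Pi.single_apply, ← eq_neg_iff_add_eq_zero] using this
  have hD : D = fromBlocks (-(D.toBlocks₁₂ * M i)) D.toBlocks₁₂
      (-(M (i + 1) * D.toBlocks₁₂ * M i)) (M (i + 1) * D.toBlocks₁₂) := by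
    have h22 : D.toBlocks₂₂ = M (i + 1) * D.toBlocks₁₂ := by
      ext s t
      exact hrow s _
    rw [← h22]
    conv_lhs => rw [← fromBlocks_toBlocks D]
    congr 1 <;>
    · ext s t
      exact hcol _ t
  rw [chart_eq_fromBlocks, hG, hG, hY, ← hD]
  ext p q
  simp [D]

theorem IsRankSeq.add_le {r : ZMod l → ℕ} (hr : IsRankSeq K n r) (i : ZMod l) :
    r (i + 1) + r i ≤ n (i + 1) := by
  obtain ⟨A, hA, hAr⟩ := hr
  simpa [hAr] using rank_add_rank_le_card_of_mul_eq_zero (hA i)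

theorem topologicalKrullDim_CompR_eq_image (r : ZMod l → ℕ) :
    letI := compTopology K n
    letI := zariskiTopology (Σ i : ZMod l, Fin (n (i + 1)) × Fin (n i)) K
    topologicalKrullDim (CompR K n r) = topologicalKrullDim (compCoord n '' CompR K n r) := by
  let := compTopology K n
  let := zariskiTopology (Σ i : ZMod l, Fin (n (i + 1)) × Fin (n i)) K
  have hemb : Topology.IsEmbedding (compCoord (K := K) n) := by
    refine ⟨⟨rfl⟩, fun A B h => ?_⟩
    funext i
    ext s t
    exact congrFun h ⟨i, s, t⟩
  exact (hemb.homeomorphImage (CompR K n r)).isHomeomorph.topologicalKrullDim_eq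

end Covering

/-- **Statement 5.** For any rank sequence `r` for `n`, the dimension of `Comp(n,r)`
(the topological Krull dimension for the Zariski topology) equals
`∑_{i ∈ ℤ/lℤ} (r_{i-1} + r_i)(n_i − r_{i-1})`. -/
theorem dim_CompR {K : Type} [Field K] [IsAlgClosed K] [CharZero K]
    {l : ℕ} [NeZero l] (n : ZMod l → ℕ) (hn : ∀ i, 0 < n i)
    (r : ZMod l → ℕ) (hr : IsRankSeq K n r) :
    letI := compTopology K n
    topologicalKrullDim (CompR K n r) =
      ((∑ i : ZMod l, (r (i - 1) + r i) * (n i - r (i - 1)) : ℕ) : WithBot ℕ∞) := by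
  rw [topologicalKrullDim_CompR_eq_image]
  let a : ZMod l → ℕ := fun i => r (i - 1)
  let b : ZMod l → ℕ := fun i => n i - a i
  have har (i : ZMod l) : a (i + 1) = r i := by simp [a]
  have hle (i : ZMod l) : a (i + 1) + a i ≤ n i := by
    simpa [a] using hr.add_le (i - 1)
  have hab (i : ZMod l) : a i + b i = n i := by have := hle i; simp only [b]; omega
  have hrb (i : ZMod l) : a (i + 1) ≤ b i := by have := hle i; simp only [b]; omega
  have hcard : Fintype.card (ChartIndex a b) =
      ∑ i : ZMod l, (r (i - 1) + r i) * (n i - r (i - 1)) := by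
    simp only [Fintype.card_sigma, Fintype.card_sum, Fintype.card_prod, Fintype.card_fin, har]
    refine Finset.sum_congr rfl fun i _ => ?_
    change b i * r (i - 1) + r i * b i = _ * b i
    ring
  rw [← hcard]
  refine le_antisymm ?_ ?_
  · refine topologicalKrullDim_le_of_subset_iUnion_range
      (fun e : ∀ i, Fin (n i) ≃ Fin (a i) ⊕ Fin (b i) => chartPoly e K) ?_
    rintro _ ⟨A, hA, rfl⟩
    obtain ⟨e, x, rfl⟩ := exists_chart_eq har hab hrb hA
    exact Set.mem_iUnion.2 ⟨e, x, polyMap_chartPoly e x⟩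
  · let e (i : ZMod l) : Fin (n i) ≃ Fin (a i) ⊕ Fin (b i) :=
      (finCongr (hab i).symm).trans finSumFinEquiv.symm
    refine card_le_topologicalKrullDim (chartPoly e K) ?_ (chartPoly_rational_inverse e hrb)
    rintro _ ⟨x, rfl⟩
    exact ⟨chart e x, chart_mem_CompR e har x, (polyMap_chartPoly e x).symm⟩
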